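/- For every prime number p with p ≡ 2 (mod 3), there is no Kochen–Specker coloring of the idempotents of the matrix ring M₃(𝔽_p) = Matrix (Fin 3) (Fin 3) (ZMod p). -/

import Mathlib

/-- A Kochen–Specker coloring of the idempotents of a ring `M`. -/
def IsKSColoring {M : Type*} [Ring M] (c : {e : M // e * e = e} → Bool) : Prop :=
  ∀ (k : ℕ) (e : Fin k → {e : M // e * e = e}),
    (∀ i j : Fin k, i ≠ j → (e i : M) * (e j : M) = 0) →
    ((∀ i j : Fin k, c (e i) = true → c (e j) = true → i = j) ∧
      ((∑ i, (e i : M)) = 1 → ∃! i : Fin k, c (e i) = true))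

open scoped Pointwise in
/-- A subset of a group that is stable under right multiplication by a subgroup has
cardinality divisible by that of the subgroup. -/
theorem Subgroup.card_dvd_card_of_mul_mem {G : Type*} [Group G] (H : Subgroup G) (T : Set G)
    (hT : ∀ g ∈ T, ∀ h ∈ H, g * h ∈ T) : Nat.card H ∣ Nat.card T := by
  have hTH : T * (H : Set G) = T := by
    refine Set.Subset.antisymm ?_ fun g hg => ⟨g, hg, 1, H.one_mem, mul_one g⟩
    rintro _ ⟨g, hg, h, hh, rfl⟩
    exact hT g hg h hh
  rw [← hTH, H.card_mul_eq_card_subgroup_mul_card_quotient]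
  exact dvd_mul_right _ _

section Conjugates

variable {R : Type*} [CommRing R]

/-- The block-diagonal embedding `A ↦ 1 ⊕ A` of `2 × 2` into `3 × 3` matrices. -/
def oneBlock : Matrix (Fin 2) (Fin 2) R →* Matrix (Fin 3) (Fin 3) R where
  toFun A := !![1, 0, 0; 0, A 0 0, A 0 1; 0, A 1 0, A 1 1]
  map_one' := by
    ext i j
    fin_cases i <;> fin_cases j <;> simp
  map_mul' A B := by
    ext i j
    fin_cases i <;> fin_cases j <;> simp [Matrix.mul_apply, Fin.sum_univ_succ]

theorem oneBlock_injective : Function.Injective (oneBlock (R := R)) := by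
  intro A B h
  ext i j
  have := congrFun (congrFun h i.succ) j.succ
  fin_cases i <;> fin_cases j <;> simpa [oneBlock] using this

theorem oneBlock_mul_single (A : Matrix (Fin 2) (Fin 2) R) :
    oneBlock A * Matrix.single 0 0 1 = Matrix.single 0 0 1 * oneBlock A := by
  ext i j
  fin_cases i <;> fin_cases j <;>
    simp [oneBlock, Matrix.mul_apply, Matrix.single_apply]

/-- The conjugate of the `i`-th diagonal matrix unit by `g`, as an idempotent. -/
def conjDiagonal (g : GL (Fin 3) R) (i : Fin 3) :
    {e : Matrix (Fin 3) (Fin 3) R // e * e = e} :=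
  ⟨g.val * Matrix.single i i 1 * g⁻¹.val, by
    simp only [mul_assoc, Units.inv_mul_cancel_left]
    rw [← mul_assoc (Matrix.single i i 1), Matrix.single_mul_single_same, mul_one]⟩

theorem conjDiagonal_mul_of_commute (g h : GL (Fin 3) R) (i : Fin 3)
    (hh : h.val * Matrix.single i i 1 = Matrix.single i i 1 * h.val) :
    conjDiagonal (g * h) i = conjDiagonal g i := by
  ext1
  simp only [conjDiagonal, mul_inv_rev, Units.val_mul]
  rw [mul_assoc _ h.val, hh]
  simp only [mul_assoc, Units.mul_inv_cancel_left]

theorem conjDiagonal_mul_swap (g : GL (Fin 3) R) (i : Fin 3) :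
    conjDiagonal (g * Matrix.GeneralLinearGroup.swap R 0 i) 0 = conjDiagonal g i := by
  have hcomm : (Matrix.GeneralLinearGroup.swap R 0 i).val * Matrix.single 0 0 1 =
      Matrix.single i i 1 * (Matrix.GeneralLinearGroup.swap R 0 i).val := by
    ext j k
    fin_cases i <;> fin_cases j <;> fin_cases k <;>
      simp [Matrix.GeneralLinearGroup.swap, Matrix.swap, Matrix.mul_apply, Fin.sum_univ_succ,
        Matrix.single_apply, PEquiv.toMatrix_apply, Equiv.swap_apply_def]
  ext1
  simp only [conjDiagonal, mul_inv_rev, Units.val_mul]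
  rw [mul_assoc _ (Matrix.GeneralLinearGroup.swap R 0 i).val, hcomm]
  simp only [mul_assoc, Units.mul_inv_cancel_left]

theorem conjDiagonal_mul_conjDiagonal (g : GL (Fin 3) R) {i j : Fin 3} (hij : i ≠ j) :
    (conjDiagonal g i : Matrix (Fin 3) (Fin 3) R) * conjDiagonal g j = 0 := by
  simp only [conjDiagonal, mul_assoc, Units.inv_mul_cancel_left]
  rw [← mul_assoc (Matrix.single i i 1), Matrix.single_mul_single_of_ne _ _ _ _ hij]
  simp

theorem sum_conjDiagonal (g : GL (Fin 3) R) :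
    ∑ i, (conjDiagonal g i : Matrix (Fin 3) (Fin 3) R) = 1 := by
  simp only [conjDiagonal]
  rw [← Finset.sum_mul, ← Finset.mul_sum, Matrix.sum_single_one, mul_one, Units.mul_inv]

/-- Exactly one third of the invertible `g` give `g E₀₀ g⁻¹` the color `true`. -/
theorem IsKSColoring.card_GL_eq [Finite R]
    {c : {e : Matrix (Fin 3) (Fin 3) R // e * e = e} → Bool}
    (hc : IsKSColoring c) :
    Nat.card (GL (Fin 3) R) =
      3 * Nat.card {g : GL (Fin 3) R | c (conjDiagonal g 0) = true} := by
  classical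
  have := Fintype.ofFinite (GL (Fin 3) R)
  have hone (g : GL (Fin 3) R) : ∑ i, (if c (conjDiagonal g i) = true then 1 else 0) = 1 := by
    obtain ⟨i, hi, huniq⟩ := (hc 3 (conjDiagonal g)
      fun _ _ => conjDiagonal_mul_conjDiagonal g).2 (sum_conjDiagonal g)
    rw [Finset.sum_eq_single i (fun j _ hj => if_neg fun h => hj (huniq j h)) (by simp),
      if_pos hi]
  have hshift (i : Fin 3) : ∑ g : GL (Fin 3) R, (if c (conjDiagonal g i) = true then 1 else 0) =
      ∑ g : GL (Fin 3) R, (if c (conjDiagonal g 0) = true then 1 else 0) := by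
    rw [← Equiv.sum_comp (Equiv.mulRight (Matrix.GeneralLinearGroup.swap R 0 i))
      fun g => if c (conjDiagonal g 0) = true then 1 else 0]
    simp only [Equiv.coe_mulRight, conjDiagonal_mul_swap]
  calc Nat.card (GL (Fin 3) R)
      = ∑ g : GL (Fin 3) R, ∑ i, (if c (conjDiagonal g i) = true then 1 else 0) := by
        simp only [hone, Finset.sum_const, Finset.card_univ, smul_eq_mul, mul_one,
          Nat.card_eq_fintype_card]
    _ = 3 * ∑ g : GL (Fin 3) R, (if c (conjDiagonal g 0) = true then 1 else 0) := by
        rw [Finset.sum_comm, Finset.sum_congr rfl fun i _ => hshift i]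
        simp
    _ = _ := by
        rw [← Finset.card_filter]
        simp only [Set.coe_ofPred, Nat.card_eq_fintype_card,
          Fintype.card_subtype]

theorem card_GL_two_dvd (c : {e : Matrix (Fin 3) (Fin 3) R // e * e = e} → Bool) :
    Nat.card (GL (Fin 2) R) ∣
      Nat.card {g : GL (Fin 3) R | c (conjDiagonal g 0) = true} := by
  have hcard : Nat.card (Units.map (oneBlock (R := R))).range = Nat.card (GL (Fin 2) R) :=
    Nat.card_range_of_injective (Units.map_injective oneBlock_injective)
  rw [← hcard]
  refine Subgroup.card_dvd_card_of_mul_mem _ _ ?_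
  rintro g hg _ ⟨A, rfl⟩
  rw [Set.mem_ofPred_eq, conjDiagonal_mul_of_commute _ _ _ (oneBlock_mul_single _)]
  exact hg

end Conjugates

/-- For every prime `p` with `p ≡ 2 (mod 3)`, there is no Kochen–Specker coloring of the
idempotents of `M₃(𝔽_p)`. -/
theorem no_KS_coloring_M3_ZMod_of_two_mod_three (p : ℕ) (hp : p.Prime) (hmod : p % 3 = 2) :
    ¬ ∃ c : {e : Matrix (Fin 3) (Fin 3) (ZMod p) // e * e = e} → Bool, IsKSColoring c := by
  rintro ⟨c, hc⟩
  have := Fact.mk hp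
  obtain ⟨k, hk⟩ := card_GL_two_dvd c
  have hcard := hc.card_GL_eq
  rw [hk, Matrix.card_GL_field, Matrix.card_GL_field] at hcard
  simp only [ZMod.card, Fin.prod_univ_three, Fin.prod_univ_two, Fin.val_zero, Fin.val_one,
    Fin.val_two, pow_zero, pow_one] at hcard
  have hp2 := hp.two_le
  have h32 : p ^ 3 - p = p * (p ^ 2 - 1) := by rw [Nat.mul_sub, mul_one, ← pow_succ']
  have h31 : p ^ 3 - p ^ 2 = p * (p ^ 2 - p) := by rw [Nat.mul_sub, ← pow_succ', ← sq]
  have hpos : 0 < (p ^ 2 - 1) * (p ^ 2 - p) :=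
    Nat.mul_pos (Nat.sub_pos_of_lt (by nlinarith)) (Nat.sub_pos_of_lt (by nlinarith))
  have hmul : (p ^ 3 - 1) * p ^ 2 = 3 * k := by
    apply Nat.eq_of_mul_eq_mul_right hpos
    rw [h32, h31] at hcard
    linear_combination hcard
  have hdvd : 3 ∣ (p ^ 3 - 1) * p ^ 2 := ⟨k, hmul⟩
  rcases Nat.prime_three.dvd_mul.mp hdvd with h | h
  · have h1 : p ^ 3 % 3 = 2 := by rw [Nat.pow_mod, hmod]
    omega
  · have := Nat.prime_three.dvd_of_dvd_pow h
    omega
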